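/- arXiv:alg-geom/9611001 — 6 statements merged into one kernel-verified Lean document; each statement's English description precedes it below -/
import Mathlib

section
/- Let B' → B = B'/t'B' be a small extension of Artin rings, where t' ∈ B' satisfies t'·m_{B'} = 0. Let F' be a B'-module such that F'/t'F' is flat as a B-module and the natural multiplication map t'B' ⊗_{B'} F' → F' is injective. Then F' is flat as a B'-module. -/
open TensorProduct

namespace Module

variable {R M : Type*} [CommRing R] [AddCommGroup M] [Module R M]

/-- A version of `Module.IsTrivialRelation` with an arbitrary finite type of generators. -/
theorem IsTrivialRelation.of_fintype {ι κ : Type*} [Fintype ι] [Fintype κ] {f : ι → R} {x : ι → M}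
    (a : ι → κ → R) (y : κ → M) (hay : ∀ i, x i = ∑ j, a i j • y j)
    (haf : ∀ j, ∑ i, f i * a i j = 0) : IsTrivialRelation f x :=
  isTrivialRelation_iff_vanishesTrivially.mpr <|
    .of_fintype a y hay fun j ↦ by simpa [mul_comm] using haf j

/-- If `(t) ⊗ M → M` is injective, every element of `M` killed by `t` is a combination of
elements of `M` with coefficients killing `t`. -/
theorem exists_eq_sum_smul_of_smul_eq_zero {t : R}
    (hinj : Function.Injective ((TensorProduct.lid R M).toLinearMap ∘ₗ
      LinearMap.rTensor M (Ideal.span {t} : Ideal R).subtype))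
    {w : M} (hw : t • w = 0) :
    ∃ (k : ℕ) (a : Fin k → R) (y : Fin k → M), w = ∑ j, a j • y j ∧ ∀ j, t * a j = 0 := by
  let s : Ideal.span {t} := ⟨t, Ideal.mem_span_singleton_self t⟩
  have hs : Submodule.span R (Set.range fun _ : Unit ↦ s) = ⊤ := by
    refine Submodule.eq_top_iff'.mpr fun ⟨z, hz⟩ ↦ ?_
    obtain ⟨c, rfl⟩ := Ideal.mem_span_singleton'.mp hz
    have hs' : s ∈ Submodule.span R (Set.range fun _ : Unit ↦ s) :=
      Submodule.subset_span ⟨(), rfl⟩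
    exact Submodule.smul_mem _ c hs'
  have hsw : s ⊗ₜ[R] w = 0 := hinj (by simpa [s] using hw)
  obtain ⟨k, a, y, hy, ha⟩ := vanishesTrivially_of_sum_tmul_eq_zero R hs
    (n := fun _ : Unit ↦ w) (by simpa using hsw)
  refine ⟨k, a (), y, hy (), fun j ↦ ?_⟩
  simpa [s, mul_comm] using congrArg Subtype.val (ha j)

/-- A relation in `M` can be trivialised modulo `t` when `M / tM` is flat over `R / (t)`. -/
theorem exists_trivialization_mod {t : R}
    [Flat (R ⧸ Ideal.span {t}) (M ⧸ (Ideal.span {t} • (⊤ : Submodule R M)))]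
    {l : ℕ} {f : Fin l → R} {x : Fin l → M} (hfx : ∑ i, f i • x i = 0) :
    ∃ (k : ℕ) (a : Fin l → Fin k ⊕ Fin l → R) (y : Fin k ⊕ Fin l → M) (c : Fin k ⊕ Fin l → R),
      (∀ i, x i = ∑ j, a i j • y j) ∧ ∀ j, ∑ i, f i * a i j = t * c j := by
  let q := (Ideal.span {t} • (⊤ : Submodule R M)).mkQ
  obtain ⟨k, a, y, hay, haf⟩ := Flat.isTrivialRelation_of_sum_smul_eq_zero
    (R := R ⧸ Ideal.span {t}) (f := fun i ↦ Ideal.Quotient.mk _ (f i)) (x := fun i ↦ q (x i))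
    (by simpa using congrArg q hfx)
  choose a ha using fun i j ↦ Ideal.Quotient.mk_surjective (a i j)
  choose y hy using fun j ↦ Submodule.mkQ_surjective _ (y j)
  obtain rfl : _ = _ := funext₂ ha
  obtain rfl : _ = _ := funext hy
  have hz (i) : ∃ z, t • z = x i - ∑ j, a i j • y j := by
    have : x i - ∑ j, a i j • y j ∈ Ideal.span {t} • (⊤ : Submodule R M) := by
      rw [← Submodule.Quotient.mk_eq_zero, ← Submodule.mkQ_apply, map_sub, sub_eq_zero, map_sum]
      exact hay i
    rw [Submodule.ideal_span_singleton_smul] at this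
    obtain ⟨z, -, hz⟩ := (Submodule.mem_smul_pointwise_iff_exists _ _ _).mp this
    exact ⟨z, hz⟩
  choose z hz using hz
  have hc (j) : ∃ c, ∑ i, f i * a i j = t * c := by
    refine Ideal.mem_span_singleton.mp (Ideal.Quotient.eq_zero_iff_mem.mp ?_)
    simpa using haf j
  choose c hc using hc
  refine ⟨k, fun i ↦ Sum.elim (a i) (Pi.single i t), Sum.elim y z, Sum.elim c f,
    fun i ↦ ?_, Sum.rec hc fun i ↦ ?_⟩
  · simp [Pi.single_apply, ite_smul, hz]
  · simp [Pi.single_apply, mul_comm]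

/-- The local criterion of flatness along a principal ideal annihilated by all non-units. -/
theorem Flat.of_flat_quotient_span_singleton {t : R} (ht : ∀ r : R, ¬ IsUnit r → t * r = 0)
    [Flat (R ⧸ Ideal.span {t}) (M ⧸ (Ideal.span {t} • (⊤ : Submodule R M)))]
    (hinj : Function.Injective ((TensorProduct.lid R M).toLinearMap ∘ₗ
      LinearMap.rTensor M (Ideal.span {t} : Ideal R).subtype)) :
    Flat R M := by
  refine .of_forall_isTrivialRelation fun {l f x} hfx ↦ ?_
  obtain ⟨k, a, y, c, hay, haf⟩ := exists_trivialization_mod (t := t) hfx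
  by_cases! hc : ∀ j, ¬ IsUnit (c j)
  · exact .of_fintype a y hay fun j ↦ by rw [haf, ht _ (hc j)]
  obtain ⟨p, hp⟩ := hc
  obtain ⟨v, hv⟩ := hp.exists_right_inv
  have hw : t • ∑ j, c j • y j = 0 := by
    simp_rw [Finset.smul_sum, ← mul_smul, ← haf, Finset.sum_smul, mul_smul]
    rw [Finset.sum_comm, ← hfx]
    simp_rw [← Finset.smul_sum, ← hay]
  obtain ⟨n, m, w, hmw, hm⟩ := exists_eq_sum_smul_of_smul_eq_zero hinj hw
  refine .of_fintype (fun i ↦ Sum.elim (fun j ↦ a i j - a i p * v * c j) fun j ↦ a i p * v * m j)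
    (Sum.elim y w) (fun i ↦ ?_) (Sum.rec (fun j ↦ ?_) fun j ↦ ?_)
  · rw [Fintype.sum_sum_type]
    simp only [Sum.elim_inl, Sum.elim_inr, sub_smul, Finset.sum_sub_distrib, mul_smul _ (c _),
      mul_smul _ (m _), ← Finset.smul_sum, ← hmw, ← hay, sub_add_cancel]
  · simp only [Sum.elim_inl, mul_sub, Finset.sum_sub_distrib, ← mul_assoc, ← Finset.sum_mul, haf]
    linear_combination (-t * c j) * hv
  · simp only [Sum.elim_inr, ← mul_assoc, ← Finset.sum_mul, haf]
    linear_combination (c p * v) * hm j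

end Module

/-- Let `B' → B = B'/t'B'` be a small extension of Artin rings (local
finite-dimensional `ℂ`-algebras), with `t'·m_{B'} = 0`. If `F'` is a `B'`-module such that
`F'/t'F'` is flat as a `B`-module and the natural multiplication map `t'B' ⊗_{B'} F' → F'`
is injective, then `F'` is flat as a `B'`-module. -/
theorem stmt1 {B' : Type} [CommRing B'] [Algebra ℂ B']
    [IsLocalRing B'] [FiniteDimensional ℂ B']
    (t' : B')
    -- `t'·m_{B'} = 0` (in a local ring the maximal ideal is the set of non-units)
    (ht' : ∀ x : B', ¬ IsUnit x → t' * x = 0)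
    (F' : Type) [AddCommGroup F'] [Module B' F']
    -- `F'/t'F'` is flat over `B = B'/t'B'`
    (hflatbar : Module.Flat (B' ⧸ Ideal.span {t'})
      (F' ⧸ ((Ideal.span {t'} : Ideal B') • (⊤ : Submodule B' F'))))
    -- the natural multiplication map `t'B' ⊗_{B'} F' → F'` is injective
    (hinj : Function.Injective
      ((TensorProduct.lid B' F').toLinearMap ∘ₗ
        LinearMap.rTensor F' (Ideal.span {t'} : Ideal B').subtype)) :
    Module.Flat B' F' := by
  exact Module.Flat.of_flat_quotient_span_singleton ht' hinj
end

section
/- Let A' → A be a small extension of Artin rings with A = A'/tA' and t·m_{A'} = 0, let B → A be a homomorphism of Artin rings, and set B' = B ×_A A'. Let E' be a flat A'-module and F a flat B-module, and suppose there is an isomorphism of A-modules φ: A ⊗_{A'} E' ≅ A ⊗_B F. Write E := A ⊗_{A'} E', with canonical surjections g: E' → E and f: F → E (the latter obtained from the canonical map F → A ⊗_B F composed with φ⁻¹). Regard E' and F as B'-modules via the two projections B' → A' and B' → B. Then the fiber product F' := E' ×_E F = {(x, y) ∈ E' × F : g(x) = f(y)} is a flat B'-module, and the canonical maps B ⊗_{B'}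 F' → F and A' ⊗_{B'} F' → E' are isomorphisms. -/
open TensorProduct

theorem Submodule.eq_top_of_sup_smul_top_of_isNilpotent {R M : Type*} [CommRing R]
    [AddCommGroup M] [Module R M] {I : Ideal R} (hI : IsNilpotent I) {N : Submodule R M}
    (h : N ⊔ I • (⊤ : Submodule R M) = ⊤) : N = ⊤ := by
  obtain ⟨n, hn⟩ := hI
  have key : ∀ k : ℕ, N ⊔ I ^ k • (⊤ : Submodule R M) = ⊤ := by
    intro k
    induction k with
    | zero => simp
    | succ k ih =>
      rw [eq_top_iff]
      calc (⊤ : Submodule R M) = N ⊔ I ^ k • (N ⊔ I • ⊤) := by rw [h, ih]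
        _ = N ⊔ (I ^ k • N ⊔ I ^ (k + 1) • ⊤) := by
          rw [Submodule.smul_sup, ← Submodule.mul_smul, pow_succ]
        _ ≤ N ⊔ I ^ (k + 1) • ⊤ :=
          sup_le le_sup_left (sup_le (Submodule.smul_le_right.trans le_sup_left) le_sup_right)
  simpa [hn] using key n

theorem Ideal.eq_bot_of_le_mul_of_isNilpotent {R : Type*} [CommRing R] {I J : Ideal R}
    (hI : IsNilpotent I) (h : J ≤ I * J) : J = ⊥ := by
  obtain ⟨n, hn⟩ := hI
  have key : ∀ k : ℕ, J ≤ I ^ k * J := by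
    intro k
    induction k with
    | zero => simp
    | succ k ih =>
      calc J ≤ I ^ k * J := ih
        _ ≤ I ^ k * (I * J) := Ideal.mul_mono_right h
        _ = I ^ (k + 1) * J := by rw [pow_succ, mul_assoc]
  simpa [hn] using key n

/-- A family in a flat module which is a basis modulo a nilpotent ideal is a basis. -/
theorem Module.Flat.exists_basis_of_isNilpotent {R M ι : Type*} [CommRing R]
    [AddCommGroup M] [Module R M] [Module.Flat R M] {I : Ideal R} (hI : IsNilpotent I)
    (v : ι → M) (hspan : Submodule.span R (Set.range v) ⊔ I • (⊤ : Submodule R M) = ⊤)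
    (hli : ∀ c : ι →₀ R, Finsupp.linearCombination R v c ∈ I • (⊤ : Submodule R M) →
      ∀ i, c i ∈ I) :
    ∃ b : Module.Basis ι R M, ⇑b = v := by
  have htop := Submodule.eq_top_of_sup_smul_top_of_isNilpotent hI hspan
  suffices h : LinearIndependent R v from ⟨.mk h htop.ge, by simp⟩
  rw [linearIndependent_iff]
  intro c hc
  have hrel : ∑ i : c.support, c i • v i = 0 := by
    rw [Finset.sum_coe_sort c.support fun i ↦ c i • v i]
    simpa [Finsupp.linearCombination_apply, Finsupp.sum] using hc
  obtain ⟨l, a, y, hy, ha⟩ := Module.Flat.isTrivialRelation_of_sum_smul_eq_zero hrel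
  have hd : ∀ j, ∃ d : ι →₀ R, Finsupp.linearCombination R v d = y j := fun j ↦ by
    rw [← LinearMap.mem_range, Finsupp.range_linearCombination, htop]
    trivial
  choose d hd using hd
  have hmem : ∀ (i : c.support) (k : ι),
      (Finsupp.single (i : ι) (1 : R) - ∑ j, a i j • d j) k ∈ I := by
    intro i k
    refine hli _ ?_ k
    have : Finsupp.linearCombination R v
        (Finsupp.single (i : ι) (1 : R) - ∑ j, a i j • d j) = 0 := by
      simp [hd, ← hy]
    rw [this]
    exact zero_mem _
  have hck : ∀ k, c k = ∑ i : c.support,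
      (Finsupp.single (i : ι) (1 : R) - ∑ j, a i j • d j) k * c i := by
    intro k
    have h1 : ∑ i : c.support, (Finsupp.single (i : ι) (1 : R)) k * c i = c k := by
      rw [Finset.sum_coe_sort c.support fun i ↦ (Finsupp.single (i : ι) (1 : R)) k * c i]
      classical
      simpa [Finsupp.single_apply] using fun h ↦ h.symm
    have h2 : ∑ i : c.support, (∑ j, a i j * d j k) * c i = 0 := by
      simp_rw [Finset.sum_mul]
      rw [Finset.sum_comm]
      refine Finset.sum_eq_zero fun j _ ↦ ?_
      calc ∑ i : c.support, a i j * d j k * c i = (∑ i : c.support, c i * a i j) * d j k := by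
            rw [Finset.sum_mul]
            exact Finset.sum_congr rfl fun i _ ↦ by ring
        _ = 0 := by rw [ha, zero_mul]
    simp only [Finsupp.coe_sub, Finsupp.coe_finsetSum, Finsupp.coe_smul, Pi.sub_apply,
      Finset.sum_apply, Pi.smul_apply, smul_eq_mul, sub_mul, Finset.sum_sub_distrib, h1, h2,
      sub_zero]
  have hJ : Ideal.span (Set.range c) = ⊥ := by
    refine Ideal.eq_bot_of_le_mul_of_isNilpotent hI (Ideal.span_le.mpr ?_)
    rintro _ ⟨k, rfl⟩
    rw [SetLike.mem_coe, hck k]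
    exact sum_mem fun i _ ↦ Ideal.mul_mem_mul (hmem i k) (Ideal.subset_span ⟨i, rfl⟩)
  ext k
  exact (Ideal.span_eq_bot.mp hJ) _ ⟨k, rfl⟩

theorem LinearMap.ker_tensorProductMk_one_of_surjective {R A M : Type*} [CommRing R] [CommRing A]
    [Algebra R A] [AddCommGroup M] [Module R M] (hA : Function.Surjective (algebraMap R A)) :
    LinearMap.ker (TensorProduct.mk R A M 1) =
      RingHom.ker (algebraMap R A) • (⊤ : Submodule R M) := by
  let e : (R ⧸ RingHom.ker (algebraMap R A)) ≃ₐ[R] A :=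
    Ideal.quotientKerAlgEquivOfSurjective (f := Algebra.ofId R A) hA
  have : TensorProduct.mk R A M 1 = (TensorProduct.congr e.toLinearEquiv (.refl R M)).toLinearMap ∘ₗ
      TensorProduct.mk R (R ⧸ RingHom.ker (algebraMap R A)) M 1 := by
    ext x
    simp
  rw [this, LinearEquiv.ker_comp, LinearMap.ker_tensorProductMk]

/-- A family in a flat module lifting a basis along a surjective algebra map with
nilpotent kernel is a basis. -/
theorem Module.Flat.exists_basis_of_basis_tensorProduct {R A M ι : Type*} [CommRing R]
    [CommRing A] [Algebra R A] [AddCommGroup M] [Module R M] [Module.Flat R M]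
    (hA : Function.Surjective (algebraMap R A)) (hI : IsNilpotent (RingHom.ker (algebraMap R A)))
    (w : Module.Basis ι A (A ⊗[R] M)) (v : ι → M) (hv : ∀ i, 1 ⊗ₜ v i = w i) :
    ∃ b : Module.Basis ι R M, ⇑b = v := by
  have hlc : ∀ c : ι →₀ R, TensorProduct.mk R A M 1 (Finsupp.linearCombination R v c) =
      Finsupp.linearCombination A w (c.mapRange (algebraMap R A) (map_zero _)) := by
    intro c
    induction c using Finsupp.induction_linear with
    | zero => simp
    | add x y hx hy => rw [Finsupp.mapRange_add (map_add _), map_add, map_add, map_add, hx, hy]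
    | single i r => simp [hv]
  refine Module.Flat.exists_basis_of_isNilpotent hI v ?_ ?_
  · rw [← LinearMap.ker_tensorProductMk_one_of_surjective hA, ← Submodule.comap_map_eq, eq_top_iff]
    intro x _
    obtain ⟨c, hc⟩ := Finsupp.mapRange_surjective (α := ι) (algebraMap R A) (map_zero _) hA
      (w.repr (1 ⊗ₜ x))
    refine ⟨Finsupp.linearCombination R v c, ?_, ?_⟩
    · rw [← Finsupp.range_linearCombination]
      exact ⟨c, rfl⟩
    · rw [hlc, hc]
      exact w.linearCombination_repr _
  · intro c hc i
    rw [← LinearMap.ker_tensorProductMk_one_of_surjective hA, LinearMap.mem_ker, hlc] at hc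
    exact DFunLike.congr_fun (linearIndependent_iff.mp w.linearIndependent _ hc) i

/-- Flat modules over local rings with nilpotent maximal ideal are free. -/
theorem Module.Flat.free_of_isNilpotent_maximalIdeal {R M : Type*} [CommRing R] [IsLocalRing R]
    [AddCommGroup M] [Module R M] [Module.Flat R M]
    (hR : IsNilpotent (IsLocalRing.maximalIdeal R)) : Module.Free R M := by
  have hsurj := IsLocalRing.residue_surjective (R := R)
  let w := Module.Free.chooseBasis (IsLocalRing.ResidueField R) (IsLocalRing.ResidueField R ⊗[R] M)
  choose v hv using fun i ↦ TensorProduct.mk_surjective R M _ hsurj (w i)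
  obtain ⟨b, -⟩ := Module.Flat.exists_basis_of_basis_tensorProduct hsurj
    (by simpa [IsLocalRing.ker_residue] using hR) w v hv
  exact .of_basis b

/-- The linear map out of a base change induced by a map carrying a basis to a basis
is bijective. -/
theorem LinearMap.liftBaseChange_bijective_of_basis {R S N P ι : Type*} [CommRing R] [CommRing S]
    [Algebra R S] [AddCommGroup N] [Module R N] [AddCommGroup P] [Module R P] [Module S P]
    [IsScalarTower R S P] (l : N →ₗ[R] P) (b : Module.Basis ι R N) (c : Module.Basis ι S P)
    (h : ∀ i, l (b i) = c i) : Function.Bijective (LinearMap.liftBaseChange S l) := by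
  have : LinearMap.liftBaseChange S l = ((b.baseChange S).equiv c (Equiv.refl ι)).toLinearMap :=
    (b.baseChange S).ext fun i ↦ by
      rw [LinearEquiv.coe_coe, Module.Basis.equiv_apply, Module.Basis.baseChange_apply]
      simp [h]
  rw [this]
  exact LinearEquiv.bijective _

/-- Gluing bases along a fiber product of rings. -/
theorem Submodule.exists_basis_of_fiberProduct {R S T A M N ι : Type*} [CommRing R] [CommRing S]
    [CommRing T] [CommRing A] [Algebra R S] [Algebra R T] (f : S →+* A) (g : T →+* A)
    [AddCommGroup M] [AddCommGroup N] [Module R M] [Module S M] [IsScalarTower R S M]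
    [Module R N] [Module T N] [IsScalarTower R T N]
    (hinj : ∀ r : R, algebraMap R S r = 0 → algebraMap R T r = 0 → r = 0)
    (hsurj : ∀ s t, f s = g t → ∃ r : R, algebraMap R S r = s ∧ algebraMap R T r = t)
    (b : Module.Basis ι S M) (c : Module.Basis ι T N) (P : Submodule R (M × N))
    (hbc : ∀ i, (b i, c i) ∈ P)
    (hP : ∀ p ∈ P, ∀ i, f (b.repr p.1 i) = g (c.repr p.2 i)) :
    ∃ d : Module.Basis ι R P, ∀ i, (d i : M × N) = (b i, c i) := by
  have hfst : ∀ a : ι →₀ R, b.repr (Finsupp.linearCombination R (fun i ↦ (⟨_, hbc i⟩ : P)) a).1.1 =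
      a.mapRange (algebraMap R S) (map_zero _) := by
    intro a
    induction a using Finsupp.induction_linear with
    | zero => simp
    | add x y hx hy =>
      rw [Finsupp.mapRange_add (map_add _), ← hx, ← hy, map_add, Submodule.coe_add, Prod.fst_add,
        map_add]
    | single i r =>
      rw [Finsupp.linearCombination_single, Submodule.coe_smul, Prod.smul_fst,
        ← algebraMap_smul S r, map_smul, Finsupp.mapRange_single, Module.Basis.repr_self,
        Finsupp.smul_single_one]
  have hsnd : ∀ a : ι →₀ R, c.repr (Finsupp.linearCombination R (fun i ↦ (⟨_, hbc i⟩ : P)) a).1.2 =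
      a.mapRange (algebraMap R T) (map_zero _) := by
    intro a
    induction a using Finsupp.induction_linear with
    | zero => simp
    | add x y hx hy =>
      rw [Finsupp.mapRange_add (map_add _), ← hx, ← hy, map_add, Submodule.coe_add, Prod.snd_add,
        map_add]
    | single i r =>
      rw [Finsupp.linearCombination_single, Submodule.coe_smul, Prod.smul_snd,
        ← algebraMap_smul T r, map_smul, Finsupp.mapRange_single, Module.Basis.repr_self,
        Finsupp.smul_single_one]
  have hli : LinearIndependent R (fun i ↦ (⟨_, hbc i⟩ : P)) := by
    rw [linearIndependent_iff]
    intro a ha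
    ext i
    refine hinj _ ?_ ?_
    · simpa [ha] using (DFunLike.congr_fun (hfst a) i).symm
    · simpa [ha] using (DFunLike.congr_fun (hsnd a) i).symm
  refine ⟨.mk hli ?_, fun i ↦ by rw [Module.Basis.mk_apply]⟩
  rintro ⟨p, hp⟩ -
  choose r hrS hrT using fun i ↦ hsurj _ _ (hP p hp i)
  classical
  let a : ι →₀ R := Finsupp.onFinset ((b.repr p.1).support ∪ (c.repr p.2).support) r fun i hi ↦ by
    contrapose! hi
    simp only [Finset.mem_union, Finsupp.mem_support_iff, not_or, not_not] at hi
    exact hinj _ ((hrS i).trans hi.1) ((hrT i).trans hi.2)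
  rw [Finsupp.mem_span_range_iff_exists_finsupp]
  refine ⟨a, ?_⟩
  change Finsupp.linearCombination R _ a = _
  refine Subtype.ext (Prod.ext (b.repr.injective ?_) (c.repr.injective ?_))
  · rw [hfst]
    ext i
    exact hrS i
  · rw [hsnd]
    ext i
    exact hrT i

/-- A flat module over a local ring `B` with nilpotent maximal ideal and a flat module over `A'`
that agree over `A` glue to a flat module over the fiber product `R = B ×_A A'`, provided `A' → A`
is surjective with nilpotent kernel. -/
theorem Module.Flat.fiberProduct {R A' A B E' F : Type*} [CommRing R] [CommRing A'] [CommRing A]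
    [CommRing B] [IsLocalRing B] [Algebra R A'] [Algebra R B] [Algebra A' A] [Algebra B A]
    [AddCommGroup E'] [AddCommGroup F] [Module R E'] [Module A' E'] [IsScalarTower R A' E']
    [Module R F] [Module B F] [IsScalarTower R B F] [Module.Flat A' E'] [Module.Flat B F]
    (hcomm : ∀ r : R, algebraMap A' A (algebraMap R A' r) = algebraMap B A (algebraMap R B r))
    (hinj : ∀ r : R, algebraMap R A' r = 0 → algebraMap R B r = 0 → r = 0)
    (hsurj : ∀ s t, algebraMap A' A s = algebraMap B A t →
      ∃ r : R, algebraMap R A' r = s ∧ algebraMap R B r = t)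
    (hB : IsNilpotent (IsLocalRing.maximalIdeal B))
    (hA : Function.Surjective (algebraMap A' A))
    (hI : IsNilpotent (RingHom.ker (algebraMap A' A)))
    (φ : (A ⊗[A'] E') ≃ₗ[A] (A ⊗[B] F)) :
    ∃ F' : Submodule R (E' × F),
      (F' : Set (E' × F)) = {p | (1 : A) ⊗ₜ[A'] p.1 = φ.symm ((1 : A) ⊗ₜ[B] p.2)} ∧
      Module.Flat R F' ∧
      Function.Bijective
        (LinearMap.liftBaseChange B ((LinearMap.snd R E' F).comp F'.subtype)) ∧
      Function.Bijective
        (LinearMap.liftBaseChange A' ((LinearMap.fst R E' F).comp F'.subtype)) := by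
  have hFree : Module.Free B F := Module.Flat.free_of_isNilpotent_maximalIdeal hB
  let c := Module.Free.chooseBasis B F
  let w := (c.baseChange A).map φ.symm
  choose v hv using fun i ↦ TensorProduct.mk_surjective A' E' A hA (w i)
  obtain ⟨b, rfl⟩ := Module.Flat.exists_basis_of_basis_tensorProduct hA hI w v hv
  let F' : Submodule R (E' × F) :=
    { carrier := {p | (1 : A) ⊗ₜ[A'] p.1 = φ.symm ((1 : A) ⊗ₜ[B] p.2)}
      zero_mem' := by simp
      add_mem' := by
        intro p q hp hq
        simp only [Set.mem_ofPred_eq, Prod.fst_add, Prod.snd_add, TensorProduct.tmul_add,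
          map_add] at hp hq ⊢
        rw [hp, hq]
      smul_mem' := by
        intro r p hp
        simp only [Set.mem_ofPred_eq, Prod.smul_fst, Prod.smul_snd] at hp ⊢
        rw [← algebraMap_smul A' r p.1, ← algebraMap_smul B r p.2, TensorProduct.tmul_smul,
          TensorProduct.tmul_smul, ← algebraMap_smul A, ← algebraMap_smul A (algebraMap R B r),
          map_smul, hp, hcomm] }
  have hbc : ∀ i, (b i, c i) ∈ F' := fun i ↦ by
    change (1 : A) ⊗ₜ[A'] b i = φ.symm ((1 : A) ⊗ₜ[B] c i)
    simpa [w] using hv i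
  have hbw : b.baseChange A = w := Module.Basis.eq_of_apply_eq fun i ↦ by
    simpa using hv i
  have hrepr : ∀ p ∈ F', ∀ i, algebraMap A' A (b.repr p.1 i) = algebraMap B A (c.repr p.2 i) := by
    intro p hp i
    have h1 : (b.baseChange A).repr (1 ⊗ₜ p.1) i = algebraMap A' A (b.repr p.1 i) := by
      rw [Module.Basis.baseChange_repr_tmul, Algebra.smul_def, mul_one]
    have h2 : w.repr (φ.symm (1 ⊗ₜ p.2)) i = algebraMap B A (c.repr p.2 i) := by
      simp [w, Algebra.smul_def]
    rw [← h1, ← h2, hbw, show (1 : A) ⊗ₜ[A'] p.1 = φ.symm ((1 : A) ⊗ₜ[B] p.2) from hp]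
  obtain ⟨d, hd⟩ := Submodule.exists_basis_of_fiberProduct (algebraMap A' A) (algebraMap B A)
    hinj hsurj b c F' hbc hrepr
  have : Module.Free R F' := .of_basis d
  exact ⟨F', rfl, inferInstance,
    LinearMap.liftBaseChange_bijective_of_basis _ d c fun i ↦ by simp [hd],
    LinearMap.liftBaseChange_bijective_of_basis _ d b fun i ↦ by simp [hd]⟩



set_option synthInstance.maxHeartbeats 1000000 in
set_option maxHeartbeats 1000000 in
/-- Let `A' → A` be a small extension of Artin rings, `B → A` a homomorphism
of Artin rings and `B' = B ×_A A'`. Let `E'` be a flat `A'`-module, `F` a flat `B`-module and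
`φ : A ⊗_{A'} E' ≅ A ⊗_B F` an isomorphism of `A`-modules. Regarding `E'` and `F` as
`B'`-modules via the two projections, the fiber product
`F' = {(x, y) : 1 ⊗ x = φ⁻¹(1 ⊗ y)}` is a flat `B'`-module and the canonical maps
`B ⊗_{B'} F' → F` and `A' ⊗_{B'} F' → E'` are isomorphisms. -/
theorem stmt2 {A' A B : Type} [CommRing A'] [CommRing A] [CommRing B]
    [Algebra ℂ A'] [Algebra ℂ A] [Algebra ℂ B]
    [IsLocalRing A'] [IsLocalRing A] [IsLocalRing B]
    [FiniteDimensional ℂ A'] [FiniteDimensional ℂ A] [FiniteDimensional ℂ B]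
    (f : A' →ₐ[ℂ] A) (g : B →ₐ[ℂ] A) (t : A')
    (hf : Function.Surjective f)
    (hker : RingHom.ker f.toRingHom = Ideal.span {t})
    (ht : ∀ x : A', ¬ IsUnit x → t * x = 0)
    (E' F : Type) [AddCommGroup E'] [AddCommGroup F]
    [Module A' E'] [Module B F] [Module.Flat A' E'] [Module.Flat B F] :
    -- regard `A` as an algebra over `A'` and over `B` via `f` and `g`
    let _instA'A : Algebra A' A := f.toRingHom.toAlgebra
    let _instBA : Algebra B A := g.toRingHom.toAlgebra
    -- the fiber product ring `B' = B ×_A A'` with its two projections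
    let B' : Subalgebra ℂ (B × A') :=
      AlgHom.equalizer (g.comp (AlgHom.fst ℂ B A')) (f.comp (AlgHom.snd ℂ B A'))
    let πA' : B' →+* A' := ((AlgHom.snd ℂ B A').comp B'.val).toRingHom
    let πB : B' →+* B := ((AlgHom.fst ℂ B A').comp B'.val).toRingHom
    -- regard `E'` and `F` as `B'`-modules via the two projections
    let _instE' : Module B' E' := Module.compHom E' πA'
    let _instF : Module B' F := Module.compHom F πB
    let _instAlgA' : Algebra B' A' := πA'.toAlgebra
    let _instAlgB : Algebra B' B := πB.toAlgebra
    let _towerE' : IsScalarTower B' A' E' :=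
      IsScalarTower.of_algebraMap_smul fun _ _ => rfl
    let _towerF : IsScalarTower B' B F :=
      IsScalarTower.of_algebraMap_smul fun _ _ => rfl
    ∀ φ : (A ⊗[A'] E') ≃ₗ[A] (A ⊗[B] F),
      -- the fiber product `F' = E' ×_E F`, where `E = A ⊗[A'] E'`,
      -- `g : E' → E, x ↦ 1 ⊗ x` and `f : F → E, y ↦ φ⁻¹(1 ⊗ y)`
      ∃ F' : Submodule B' (E' × F),
        (F' : Set (E' × F))
          = {p : E' × F | (1 : A) ⊗ₜ[A'] p.1 = φ.symm ((1 : A) ⊗ₜ[B] p.2)} ∧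
        -- `F'` is a flat `B'`-module
        Module.Flat B' F' ∧
        -- the canonical map `B ⊗[B'] F' → F` is an isomorphism
        Function.Bijective
          (LinearMap.liftBaseChange B ((LinearMap.snd B' E' F).comp F'.subtype)) ∧
        -- the canonical map `A' ⊗[B'] F' → E'` is an isomorphism
        Function.Bijective
          (LinearMap.liftBaseChange A' ((LinearMap.fst B' E' F).comp F'.subtype)) := by
  intro instA'A instBA B' πA' πB instE' instF instAlgA' instAlgB towerE' towerF φ
  have : IsArtinianRing B := IsArtinianRing.of_finite ℂ B
  refine Module.Flat.fiberProduct (fun r ↦ r.2.symm) (fun r h1 h2 ↦ Subtype.ext (Prod.ext h2 h1))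
    (fun s t h ↦ ⟨⟨(t, s), h.symm⟩, rfl, rfl⟩) ?_ hf ?_ φ
  · rw [← IsLocalRing.jacobson_eq_maximalIdeal ⊥ bot_ne_top]
    exact IsArtinianRing.isNilpotent_jacobson_bot
  · have htu : ¬ IsUnit t := fun h ↦ by
      have h0 : f t = 0 := by
        have : t ∈ RingHom.ker f.toRingHom := hker ▸ Ideal.mem_span_singleton_self t
        exact this
      exact (h.map f).ne_zero h0
    refine ⟨2, ?_⟩
    change RingHom.ker f.toRingHom ^ 2 = 0
    rw [hker, Ideal.span_singleton_pow, sq, ht t htu, Ideal.zero_eq_bot, Ideal.span_singleton_eq_bot]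
end

section
/- Let R be a commutative ring, J ⊆ R an ideal, M an R-module, and 0 → JM →(i) F →(q) M → 0 a short exact sequence of R-modules, where JM ⊆ M denotes the submodule generated by all products jm with j ∈ J, m ∈ M. Let E be the pushout of i: JM → F along the inclusion JM ↪ M, i.e. E = (F ⊕ M)/{(i(z), −z) : z ∈ JM}. Then the induced sequence 0 → M → E → M → 0 is exact (the first map induced by M ↪ F ⊕ M on the second summand, the second induced by q on the first summand and zero on the second), and there is an isomorphism of R/J-modules E/JE ≅ (M/JM) ⊕ (M/JM). -/
open Submodule

/-- Given a short exact sequence `0 → JM → F → M → 0` of `R`-modules and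
the pushout `E` of `i : JM → F` along the inclusion `JM ↪ M`, the induced sequence
`0 → M → E → M → 0` is exact (the first map induced by the inclusion of the second summand,
the second induced by `q` on the first summand and zero on the second) and
`E/JE ≅ (M/JM) ⊕ (M/JM)`. -/
theorem stmt5 {R M F : Type*} [CommRing R] (J : Ideal R)
    [AddCommGroup M] [Module R M] [AddCommGroup F] [Module R F]
    (i : ↥(J • (⊤ : Submodule R M)) →ₗ[R] F) (q : F →ₗ[R] M)
    (hi : Function.Injective i) (hq : Function.Surjective q)
    (hexact : LinearMap.range i = LinearMap.ker q)
    -- the pushout `E = (F ⊕ M) / {(i z, -z) : z ∈ JM}`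
    (N : Submodule R (F × M))
    (hN : N = LinearMap.range (LinearMap.prod i (-(J • (⊤ : Submodule R M)).subtype)))
    -- the first map `M → E`, induced by the inclusion of the second summand
    (j : M →ₗ[R] (F × M) ⧸ N) (hj : j = N.mkQ ∘ₗ LinearMap.inr R F M) :
    Function.Injective j ∧
    (∃ π : ((F × M) ⧸ N) →ₗ[R] M,
      -- `π` is induced by `q` on the first summand and zero on the second
      π ∘ₗ N.mkQ = q ∘ₗ LinearMap.fst R F M ∧
      Function.Surjective π ∧ LinearMap.range j = LinearMap.ker π) ∧
    Nonempty ((((F × M) ⧸ N) ⧸ (J • (⊤ : Submodule R ((F × M) ⧸ N)))) ≃ₗ[R]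
      ((M ⧸ (J • (⊤ : Submodule R M))) × (M ⧸ (J • (⊤ : Submodule R M))))) := by
  subst hj
  generalize hP : J • (⊤ : Submodule R M) = P at *
  have hqi (z) : q (i z) = 0 := by
    rw [← LinearMap.mem_ker, ← hexact]
    exact LinearMap.mem_range_self i z
  have hmem (z : P) : (i z, -(z : M)) ∈ N := hN ▸ LinearMap.mem_range_self _ z
  have glue (z : P) : N.mkQ (i z, 0) = N.mkQ (0, (z : M)) := by
    rw [← sub_eq_zero, ← map_sub, mkQ_apply, Quotient.mk_eq_zero]
    simpa using hmem z
  refine ⟨?_, ⟨N.liftQ (q ∘ₗ LinearMap.fst R F M) ?_, N.liftQ_mkQ _ _, ?_, ?_⟩, ?_⟩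
  · rw [injective_iff_map_eq_zero]
    intro m hm
    obtain ⟨z, hz⟩ := hN ▸ (Quotient.mk_eq_zero N).1 hm
    have hz1 : i z = 0 := congrArg Prod.fst hz
    have hz2 : -(z : M) = m := congrArg Prod.snd hz
    have hz0 : z = 0 := hi (hz1.trans (map_zero i).symm)
    simpa [hz0] using hz2.symm
  · rw [hN]
    rintro _ ⟨z, rfl⟩
    exact hqi z
  · intro m
    obtain ⟨f, rfl⟩ := hq m
    exact ⟨N.mkQ (f, 0), rfl⟩
  · apply le_antisymm
    · rintro _ ⟨m, rfl⟩
      exact map_zero q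
    · intro e he
      obtain ⟨⟨f, m⟩, rfl⟩ := N.mkQ_surjective e
      have hf : f ∈ LinearMap.range i := hexact ▸ LinearMap.mem_ker.2 he
      obtain ⟨z, rfl⟩ := hf
      refine ⟨z + m, ?_⟩
      have h : ((i z, m) : F × M) = (i z, 0) + (0, m) := by simp
      rw [h, map_add, map_add, glue]
      rfl
  · let φ : F × M →ₗ[R] (M ⧸ P) × (M ⧸ P) := (P.mkQ ∘ₗ q).prodMap P.mkQ
    have hφ : N ≤ LinearMap.ker φ := by
      rw [hN]
      rintro _ ⟨z, rfl⟩
      refine LinearMap.mem_ker.2 (Prod.ext ?_ ?_)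
      · change P.mkQ (q (i z)) = 0
        rw [hqi, map_zero]
      · exact (Quotient.mk_eq_zero P).2 (neg_mem z.2)
    have hsurj : Function.Surjective (N.liftQ φ hφ) := by
      rintro ⟨a, b⟩
      obtain ⟨a, rfl⟩ := (P.mkQ_surjective.comp hq) a
      obtain ⟨b, rfl⟩ := P.mkQ_surjective b
      exact ⟨N.mkQ (a, b), rfl⟩
    have hinr {m : M} (hm : m ∈ P) : N.mkQ (0, m) ∈ J • (⊤ : Submodule R ((F × M) ⧸ N)) :=
      smul_top_le_comap_smul_top J (N.mkQ ∘ₗ LinearMap.inr R F M) (hP.symm ▸ hm)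
    have hker : J • (⊤ : Submodule R ((F × M) ⧸ N)) = LinearMap.ker (N.liftQ φ hφ) := by
      apply le_antisymm
      · rw [smul_le]
        intro r hr e _
        obtain ⟨⟨f, m⟩, rfl⟩ := N.mkQ_surjective e
        refine LinearMap.mem_ker.2 (Prod.ext ?_ ?_)
        · change P.mkQ (q (r • f)) = 0
          rw [map_smul]
          exact (Quotient.mk_eq_zero P).2 (hP ▸ smul_mem_smul hr mem_top)
        · exact (Quotient.mk_eq_zero P).2 (hP ▸ smul_mem_smul hr mem_top)
      · intro e he
        obtain ⟨⟨f, m⟩, rfl⟩ := N.mkQ_surjective e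
        have he' : φ (f, m) = 0 := he
        have hf : q f ∈ P := (Quotient.mk_eq_zero P).1 (congrArg Prod.fst he')
        have hm : m ∈ P := (Quotient.mk_eq_zero P).1 (congrArg Prod.snd he')
        have hPq : P = (J • (⊤ : Submodule R F)).map q := by
          rw [map_smul'', Submodule.map_top, LinearMap.range_eq_top.2 hq, hP]
        obtain ⟨f', hf', hff'⟩ : q f ∈ (J • (⊤ : Submodule R F)).map q := hPq ▸ hf
        obtain ⟨z, hz⟩ : f - f' ∈ LinearMap.range i := by
          rw [hexact, LinearMap.mem_ker, map_sub, hff', sub_self]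
        have h : ((f, m) : F × M) = (f', 0) + (i z, 0) + (0, m) := by simp [hz]
        rw [h, map_add, map_add, glue]
        exact add_mem (add_mem
          (smul_top_le_comap_smul_top J (N.mkQ ∘ₗ LinearMap.inl R F M) hf') (hinr z.2)) (hinr hm)
    subst hP
    exact ⟨(quotEquivOfEq _ _ hker).trans ((N.liftQ φ hφ).quotKerEquivOfSurjective hsurj)⟩
end

section
/- Let R be a commutative ℂ-algebra, J ⊆ R an ideal, M a finitely generated projective R-module, and W₀ := M/JM. A framed first-order deformation of M is a triple (E, α, ψ) where: E is a module over R[ε] which is flat over the ring of dual numbers ℂ[ε]; ψ: E/εE ≅ M is an isomorphism of R-modules; and α: E/JE ≅ W₀ ⊗_ℂ ℂ[ε] = W₀ ⊕ εW₀ is an isomorphism of R[ε]-modules (J acting through R ⊆ R[ε]) such that the isomorphism E/(JE + εE) ≅ W₀ induced by α coincides with the isomorphism induced by ψ followed by the canonical projection M → M/JM. An isomorphism of framed first-order deformations (E, α, ψ) → (E', α', ψ') is an isomorphism h: E → E' of R[ε]-modules with α' ∘ (h mod J) = α and ψ' ∘ (h mod ε) = ψ. Then the set of isomorphism classes of framed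 first-order deformations of M is in natural bijection with Ext¹_R(M, JM). -/
open TrivSqZeroExt

/-- Multiplication by `ε` on a module over the dual numbers `R[ε]`, as an `R`-linear map. -/
def epsMul (R E : Type) [CommRing R] [AddCommGroup E] [Module (DualNumber R) E] [Module R E]
    [IsScalarTower R (DualNumber R) E] : E →ₗ[R] E :=
  (LinearMap.lsmul (DualNumber R) E DualNumber.eps).restrictScalars R

/-- A framed first-order deformation of an `R`-module `M` with framing ideal `J`:
a module `E` over `R[ε]`, flat over the dual numbers `ℂ[ε]`, together with an isomorphism
`ψ : E/εE ≅ M` of `R`-modules and a framing `α : E/JE ≅ W₀ ⊕ εW₀` of `R[ε]`-modules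
(`W₀ = M/JM`, `J` acting through `R ⊆ R[ε]`, `ε·(w₁, w₂) = (0, w₁)`), such that the
isomorphism `E/(JE + εE) ≅ W₀` induced by `α` coincides with the one induced by `ψ`. -/
structure FramedFODef (R : Type) [CommRing R] [Algebra ℂ R] (J : Ideal R)
    (M : Type) [AddCommGroup M] [Module R M] where
  E : Type
  [addE : AddCommGroup E]
  [modDR : Module (DualNumber R) E]
  [modR : Module R E]
  [tower : IsScalarTower R (DualNumber R) E]
  [modDC : Module (DualNumber ℂ) E]
  /-- the `ℂ[ε]`-module structure is the restriction of the `R[ε]`-module structure -/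
  compatC : ∀ (d : DualNumber ℂ) (x : E),
    d • x = (inl (algebraMap ℂ R (fst d)) + inr (algebraMap ℂ R (snd d)) : DualNumber R) • x
  /-- `E` is flat over the dual numbers `ℂ[ε]` -/
  flat : Module.Flat (DualNumber ℂ) E
  /-- `ψ : E/εE ≅ M` -/
  ψ : (E ⧸ LinearMap.range (epsMul R E)) ≃ₗ[R] M
  /-- the framing `α : E/JE ≅ W₀ ⊕ εW₀` -/
  α : (E ⧸ (J • (⊤ : Submodule R E))) ≃ₗ[R]
      ((M ⧸ (J • (⊤ : Submodule R M))) × (M ⧸ (J • (⊤ : Submodule R M))))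
  /-- `α` is `R[ε]`-linear: `ε` sends `w₁ + εw₂` to `εw₁` -/
  compat_eps : ∀ x : E,
    α (Submodule.Quotient.mk ((DualNumber.eps : DualNumber R) • x))
      = (0, (α (Submodule.Quotient.mk x)).1)
  /-- the reductions mod `J` of `ψ` and `α` coincide -/
  compat_psi : ∀ x : E,
    Submodule.Quotient.mk (p := J • (⊤ : Submodule R M)) (ψ (Submodule.Quotient.mk x))
      = (α (Submodule.Quotient.mk x)).1

attribute [instance] FramedFODef.addE FramedFODef.modDR FramedFODef.modR FramedFODef.tower
  FramedFODef.modDC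

/-- Isomorphism of framed first-order deformations: an isomorphism of `R[ε]`-modules
commuting with the framings `α` and the identifications `ψ`. -/
def FramedFODef.Iso {R : Type} [CommRing R] [Algebra ℂ R] {J : Ideal R}
    {M : Type} [AddCommGroup M] [Module R M] (D D' : FramedFODef R J M) : Prop :=
  ∃ h : D.E ≃ₗ[DualNumber R] D'.E,
    (∀ x : D.E, D'.α (Submodule.Quotient.mk (h x)) = D.α (Submodule.Quotient.mk x)) ∧
    (∀ x : D.E, D'.ψ (Submodule.Quotient.mk (h x)) = D.ψ (Submodule.Quotient.mk x))

/-- The module `N[ε] = N ⊕ εN` over the dual numbers, with `(m, n)` standing for `m + εn`. -/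
def DualPair (N : Type) : Type := N × N

namespace DualPair

/-- The element `m + εn` of `N ⊕ εN`. -/
def mk {N : Type} (m n : N) : DualPair N := (m, n)

instance (N : Type) [AddCommGroup N] : AddCommGroup (DualPair N) :=
  inferInstanceAs (AddCommGroup (N × N))

instance (S N : Type) [CommRing S] [AddCommGroup N] [Module S N] : Module S (DualPair N) :=
  inferInstanceAs (Module S (N × N))

instance (S N : Type) [CommRing S] [AddCommGroup N] [Module S N] :
    Module (DualNumber S) (DualPair N) where
  smul d x := (fst d • x.1, fst d • x.2 + snd d • x.1)
  one_smul x := by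
    refine Prod.ext ?_ ?_
    · change fst (1 : DualNumber S) • x.1 = x.1
      simp
    · change fst (1 : DualNumber S) • x.2 + snd (1 : DualNumber S) • x.1 = x.2
      simp
  mul_smul d e x := by
    refine Prod.ext ?_ ?_
    · change fst (d * e) • x.1 = fst d • fst e • x.1
      simp [mul_smul]
    · change fst (d * e) • x.2 + snd (d * e) • x.1
        = fst d • (fst e • x.2 + snd e • x.1) + snd d • fst e • x.1
      simp only [fst_mul, DualNumber.snd_mul]
      module
  smul_zero d := by
    refine Prod.ext ?_ ?_
    · exact smul_zero (fst d)
    · change fst d • (0 : N) + snd d • (0 : N) = 0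
      simp
  smul_add d x y := by
    refine Prod.ext ?_ ?_
    · exact smul_add (fst d) x.1 y.1
    · change fst d • (x.2 + y.2) + snd d • (x.1 + y.1)
        = (fst d • x.2 + snd d • x.1) + (fst d • y.2 + snd d • y.1)
      module
  add_smul d e x := by
    refine Prod.ext ?_ ?_
    · exact add_smul (fst d) (fst e) x.1
    · change fst (d + e) • x.2 + snd (d + e) • x.1
        = (fst d • x.2 + snd d • x.1) + (fst e • x.2 + snd e • x.1)
      simp only [fst_add, snd_add]
      module
  zero_smul x := by
    refine Prod.ext ?_ ?_
    · exact zero_smul S x.1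
    · change fst (0 : DualNumber S) • x.2 + snd (0 : DualNumber S) • x.1 = 0
      simp

variable {S N : Type} [CommRing S] [AddCommGroup N] [Module S N]

theorem smul_def (d : DualNumber S) (x : DualPair N) :
    d • x = mk (fst d • x.1) (fst d • x.2 + snd d • x.1) := rfl

theorem eps_smul (x : DualPair N) :
    (DualNumber.eps : DualNumber S) • x = mk 0 x.1 := by
  rw [smul_def, DualNumber.fst_eps, DualNumber.snd_eps, zero_smul, zero_smul, one_smul, zero_add]

instance : IsScalarTower S (DualNumber S) (DualPair N) where
  smul_assoc s d x := by
    refine Prod.ext ?_ ?_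
    · change (s * fst d) • x.1 = s • fst d • x.1
      exact mul_smul _ _ _
    · change (s * fst d) • x.2 + (s * snd d) • x.1 = s • (fst d • x.2 + snd d • x.1)
      module

variable (S N) in
/-- The linear equivalence between `N ⊕ εN` and `N × N`. -/
def equivProd : DualPair N ≃ₗ[S] N × N := LinearEquiv.refl S (N × N)

variable (S N) in
/-- The inclusion of `N` into `N ⊕ εN`. -/
def incl : N →ₗ[S] DualPair N := LinearMap.inl S N N

variable (S N) in
theorem isBaseChange_incl : IsBaseChange (DualNumber S) (incl S N) := by
  refine IsBaseChange.of_lift_unique _ fun Q _ _ _ _ g ↦ ?_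
  have key (x : DualPair N) :
      x = incl S N x.1 + (DualNumber.eps : DualNumber S) • incl S N x.2 := by
    rw [eps_smul]
    refine Prod.ext ?_ ?_
    · exact (add_zero x.1).symm
    · exact (zero_add x.2).symm
  have hd (d : DualNumber S) (q : Q) :
      d • q = fst d • q + snd d • (DualNumber.eps : DualNumber S) • q := by
    rw [← smul_assoc, ← algebraMap_smul (DualNumber S) (fst d) q, ← add_smul]
    congr 1
    ext <;> simp [TrivSqZeroExt.algebraMap_eq_inl]
  have he (q : Q) : (DualNumber.eps : DualNumber S) • (DualNumber.eps : DualNumber S) • q = 0 := by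
    rw [smul_smul, DualNumber.eps_mul_eps, zero_smul]
  refine ⟨{ toFun := fun x ↦ g x.1 + (DualNumber.eps : DualNumber S) • g x.2
            map_add' := fun x y ↦ ?_
            map_smul' := fun d x ↦ ?_ }, ?_, ?_⟩
  · change g (x.1 + y.1) + (DualNumber.eps : DualNumber S) • g (x.2 + y.2) = _
    simp only [map_add, smul_add]
    abel
  · change g (fst d • x.1) + (DualNumber.eps : DualNumber S) • g (fst d • x.2 + snd d • x.1)
      = d • (g x.1 + (DualNumber.eps : DualNumber S) • g x.2)
    rw [smul_add, hd d (g x.1), hd d (_ • _), he]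
    simp only [map_add, map_smul, smul_add, smul_zero, add_zero]
    rw [smul_comm (fst d) (DualNumber.eps : DualNumber S),
      smul_comm (snd d) (DualNumber.eps : DualNumber S)]
    abel
  · ext n
    change g n + (DualNumber.eps : DualNumber S) • g 0 = g n
    simp
  · intro f hf
    ext x
    have hf' (n : N) : f (incl S N n) = g n := LinearMap.congr_fun hf n
    change f x = g x.1 + (DualNumber.eps : DualNumber S) • g x.2
    conv_lhs => rw [key x, map_add, map_smul, hf', hf']

theorem smul_top_eq_ker (J : Ideal S) :
    J • (⊤ : Submodule S (DualPair N)) =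
      LinearMap.ker ((J • (⊤ : Submodule S N)).mkQ.prodMap (J • (⊤ : Submodule S N)).mkQ ∘ₗ
        (equivProd S N).toLinearMap) := by
  apply le_antisymm
  · rw [Submodule.smul_le]
    intro r hr x _
    rw [LinearMap.mem_ker]
    refine Prod.ext ?_ ?_
    · exact (Submodule.Quotient.mk_eq_zero _).2 (Submodule.smul_mem_smul hr Submodule.mem_top)
    · exact (Submodule.Quotient.mk_eq_zero _).2 (Submodule.smul_mem_smul hr Submodule.mem_top)
  · intro x hx
    have h1 : x.1 ∈ J • (⊤ : Submodule S N) :=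
      (Submodule.Quotient.mk_eq_zero _).1 (congrArg Prod.fst (LinearMap.mem_ker.1 hx))
    have h2 : x.2 ∈ J • (⊤ : Submodule S N) :=
      (Submodule.Quotient.mk_eq_zero _).1 (congrArg Prod.snd (LinearMap.mem_ker.1 hx))
    have hmap (f : N →ₗ[S] DualPair N) {n : N} (hn : n ∈ J • (⊤ : Submodule S N)) :
        f n ∈ J • (⊤ : Submodule S (DualPair N)) := by
      have := Submodule.mem_map_of_mem (f := f) hn
      rw [Submodule.map_smul''] at this
      exact Submodule.smul_mono le_rfl le_top this
    have hx' : x = ((equivProd S N).symm.toLinearMap ∘ₗ LinearMap.inl S N N) x.1 +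
        ((equivProd S N).symm.toLinearMap ∘ₗ LinearMap.inr S N N) x.2 :=
      Prod.ext (add_zero x.1).symm (zero_add x.2).symm
    rw [hx']
    exact add_mem (hmap _ h1) (hmap _ h2)

theorem range_epsMul :
    LinearMap.range (epsMul S (DualPair N)) =
      LinearMap.ker (LinearMap.fst S N N ∘ₗ (equivProd S N).toLinearMap) := by
  apply le_antisymm
  · rintro _ ⟨x, rfl⟩
    change ((DualNumber.eps : DualNumber S) • x).1 = 0
    rw [eps_smul]
    rfl
  · intro x hx
    refine ⟨mk x.2 0, ?_⟩
    refine (eps_smul (S := S) _).trans (Prod.ext ?_ rfl)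
    exact (LinearMap.mem_ker.1 hx).symm

end DualPair

namespace FramedFODef

variable {R : Type} [CommRing R] [Algebra ℂ R] {J : Ideal R} {M : Type} [AddCommGroup M]
  [Module R M]

variable (J M) in
/-- The trivial framed first-order deformation `M ⊕ εM`. -/
noncomputable def trivial : FramedFODef R J M :=
  letI : Module ℂ M := Module.compHom M (algebraMap ℂ R)
  { E := DualPair M
    compatC := fun d x ↦ by
      refine Prod.ext ?_ ?_
      · change algebraMap ℂ R (fst d) • x.1
          = (algebraMap ℂ R (fst d) + 0 : R) • x.1
        rw [add_zero]
      · change algebraMap ℂ R (fst d) • x.2 + algebraMap ℂ R (snd d) • x.1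
          = (algebraMap ℂ R (fst d) + 0 : R) • x.2 + (0 + algebraMap ℂ R (snd d) : R) • x.1
        rw [add_zero, zero_add]
    flat := Module.Flat.isBaseChange ℂ (DualNumber ℂ) M (DualPair M)
      (DualPair.isBaseChange_incl ℂ M)
    ψ := (Submodule.quotEquivOfEq _ _ DualPair.range_epsMul).trans
      (LinearMap.quotKerEquivOfSurjective _
        (Prod.fst_surjective.comp (DualPair.equivProd R M).surjective))
    α := (Submodule.quotEquivOfEq _ _ (DualPair.smul_top_eq_ker J)).trans
      (LinearMap.quotKerEquivOfSurjective _
        ((Prod.map_surjective.2 ⟨Submodule.mkQ_surjective _, Submodule.mkQ_surjective _⟩).comp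
          (DualPair.equivProd R M).surjective))
    compat_eps := fun x ↦ by
      rw [DualPair.eps_smul]
      rfl
    compat_psi := fun x ↦ rfl }

variable (D : FramedFODef R J M)

theorem ψ_eps_smul (x : D.E) :
    D.ψ (Submodule.Quotient.mk ((DualNumber.eps : DualNumber R) • x)) = 0 := by
  have hx : (DualNumber.eps : DualNumber R) • x ∈ LinearMap.range (epsMul R D.E) := ⟨x, rfl⟩
  rw [(Submodule.Quotient.mk_eq_zero _).2 hx, map_zero]

theorem eps_smul_eps_smul (x : D.E) :
    (DualNumber.eps : DualNumber R) • (DualNumber.eps : DualNumber R) • x = 0 := by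
  rw [smul_smul, DualNumber.eps_mul_eps, zero_smul]

theorem exists_eps_smul_of_ψ_eq_zero {x : D.E} (hx : D.ψ (Submodule.Quotient.mk x) = 0) :
    ∃ y : D.E, (DualNumber.eps : DualNumber R) • y = x := by
  rw [map_eq_zero_iff _ D.ψ.injective, Submodule.Quotient.mk_eq_zero] at hx
  exact hx

theorem complex_eps_smul (x : D.E) :
    (DualNumber.eps : DualNumber ℂ) • x = (DualNumber.eps : DualNumber R) • x := by
  rw [D.compatC]
  congr 1
  ext <;> simp

/-- By flatness over `ℂ[ε]`, the kernel of multiplication by `ε` is contained in its image. -/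
theorem ψ_eq_zero_of_eps_smul_eq_zero {x : D.E}
    (hx : (DualNumber.eps : DualNumber R) • x = 0) : D.ψ (Submodule.Quotient.mk x) = 0 := by
  have := D.flat
  obtain ⟨k, a, y, hxy, ha⟩ := Module.Flat.isTrivialRelation_of_sum_smul_eq_zero
    (R := DualNumber ℂ) (M := D.E) (ι := Unit) (f := fun _ ↦ DualNumber.eps) (x := fun _ ↦ x)
    (by simpa [D.complex_eps_smul] using hx)
  have hxy' : x = ∑ j, a () j • y j := hxy ()
  rw [hxy', ← Submodule.mkQ_apply, map_sum, map_sum]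
  refine Finset.sum_eq_zero fun j _ ↦ ?_
  have h0 : fst (a () j) = 0 := by
    have := congrArg snd (ha j)
    simpa using this
  have h1 : a () j = DualNumber.eps * inl (snd (a () j)) := by
    ext <;> simp [h0]
  rw [h1, mul_smul, D.complex_eps_smul, Submodule.mkQ_apply, D.ψ_eps_smul]

/-- For projective `M`, the map `ψ` has a linear section which is compatible with the framing. -/
theorem exists_section [Module.Projective R M] :
    ∃ s : M →ₗ[R] D.E, ∀ m, D.ψ (Submodule.Quotient.mk (s m)) = m ∧
      D.α (Submodule.Quotient.mk (s m)) = (Submodule.Quotient.mk m, 0) := by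
  let f : D.E →ₗ[R] M × (M ⧸ (J • (⊤ : Submodule R M))) :=
    (D.ψ.toLinearMap ∘ₗ Submodule.mkQ _).prod
      (LinearMap.snd R _ _ ∘ₗ D.α.toLinearMap ∘ₗ Submodule.mkQ _)
  have hf : Function.Surjective f := by
    rintro ⟨m, w⟩
    obtain ⟨q, hq⟩ := D.ψ.surjective m
    obtain ⟨x, rfl⟩ := Submodule.Quotient.mk_surjective _ q
    obtain ⟨n, hn⟩ := Submodule.Quotient.mk_surjective _
      (w - (D.α (Submodule.Quotient.mk x)).2)
    obtain ⟨q', hq'⟩ := D.ψ.surjective n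
    obtain ⟨y, rfl⟩ := Submodule.Quotient.mk_surjective _ q'
    refine ⟨x + (DualNumber.eps : DualNumber R) • y, Prod.ext ?_ ?_⟩
    · change D.ψ (Submodule.Quotient.mk (x + _)) = m
      rw [Submodule.Quotient.mk_add, map_add, D.ψ_eps_smul, hq, add_zero]
    · change (D.α (Submodule.Quotient.mk (x + _))).2 = w
      rw [Submodule.Quotient.mk_add, map_add, D.compat_eps, ← D.compat_psi, hq', hn]
      simp
  obtain ⟨s, hs⟩ := Module.projective_lifting_property f (LinearMap.inl R M _) hf
  have h1 (m : M) : D.ψ (Submodule.Quotient.mk (s m)) = m :=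
    congrArg Prod.fst (LinearMap.congr_fun hs m)
  have h2 (m : M) : (D.α (Submodule.Quotient.mk (s m))).2 = 0 :=
    congrArg Prod.snd (LinearMap.congr_fun hs m)
  refine ⟨s, fun m ↦ ⟨h1 m, Prod.ext ?_ (h2 m)⟩⟩
  rw [← D.compat_psi, h1]

/-- For projective `M`, every framed first-order deformation is isomorphic to the trivial one. -/
theorem trivial_iso [Module.Projective R M] :
    ∃ e : DualPair M ≃ₗ[DualNumber R] D.E, ∀ x,
      D.α (Submodule.Quotient.mk (e x)) = (Submodule.Quotient.mk x.1, Submodule.Quotient.mk x.2) ∧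
      D.ψ (Submodule.Quotient.mk (e x)) = x.1 := by
  obtain ⟨s, hs⟩ := D.exists_section
  let e₀ : DualPair M →ₗ[DualNumber R] D.E :=
    { toFun := fun x ↦ s x.1 + (DualNumber.eps : DualNumber R) • s x.2
      map_add' := fun x y ↦ by
        change s (x.1 + y.1) + (DualNumber.eps : DualNumber R) • s (x.2 + y.2) = _
        simp only [map_add, smul_add]
        abel
      map_smul' := fun d x ↦ by
        have hd (q : D.E) : d • q = fst d • q + snd d • (DualNumber.eps : DualNumber R) • q := by
          rw [← smul_assoc, ← algebraMap_smul (DualNumber R) (fst d) q, ← add_smul]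
          congr 1
          ext <;> simp [TrivSqZeroExt.algebraMap_eq_inl]
        change s (fst d • x.1) + (DualNumber.eps : DualNumber R) • s (fst d • x.2 + snd d • x.1)
          = d • (s x.1 + (DualNumber.eps : DualNumber R) • s x.2)
        rw [smul_add, hd (s x.1), hd (_ • _), D.eps_smul_eps_smul]
        simp only [map_add, map_smul, smul_add, smul_zero, add_zero]
        rw [smul_comm (fst d) (DualNumber.eps : DualNumber R),
          smul_comm (snd d) (DualNumber.eps : DualNumber R)]
        abel }
  have he (x : DualPair M) : e₀ x = s x.1 + (DualNumber.eps : DualNumber R) • s x.2 := rfl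
  have hψ (x : DualPair M) : D.ψ (Submodule.Quotient.mk (e₀ x)) = x.1 := by
    rw [he, Submodule.Quotient.mk_add, map_add, D.ψ_eps_smul, add_zero, (hs _).1]
  refine ⟨LinearEquiv.ofBijective e₀ ⟨?_, ?_⟩, fun x ↦ ⟨?_, hψ x⟩⟩
  · rw [injective_iff_map_eq_zero]
    intro x hx
    have h1 : x.1 = 0 := by
      rw [← hψ x, hx, Submodule.Quotient.mk_zero, map_zero]
    rw [he, h1, map_zero, zero_add] at hx
    have h2 := D.ψ_eq_zero_of_eps_smul_eq_zero hx
    rw [(hs _).1] at h2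
    exact Prod.ext h1 h2
  · have hsub (x : D.E) : ∃ y, (DualNumber.eps : DualNumber R) • y
        = x - s (D.ψ (Submodule.Quotient.mk x)) := by
      apply D.exists_eps_smul_of_ψ_eq_zero
      rw [Submodule.Quotient.mk_sub, map_sub, (hs _).1, sub_self]
    intro x
    obtain ⟨y, hy⟩ := hsub x
    obtain ⟨z, hz⟩ := hsub y
    refine ⟨DualPair.mk (D.ψ (Submodule.Quotient.mk x)) (D.ψ (Submodule.Quotient.mk y)), ?_⟩
    have h := congrArg (fun t ↦ (DualNumber.eps : DualNumber R) • t) hz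
    simp only [D.eps_smul_eps_smul, smul_sub] at h
    change s (D.ψ (Submodule.Quotient.mk x)) +
      (DualNumber.eps : DualNumber R) • s (D.ψ (Submodule.Quotient.mk y)) = x
    rw [← sub_eq_zero.1 h.symm, hy, add_sub_cancel]
  · change D.α (Submodule.Quotient.mk (e₀ x)) = _
    rw [he, Submodule.Quotient.mk_add, map_add, D.compat_eps, (hs _).2, (hs _).2]
    simp

theorem iso_of_projective [Module.Projective R M] (D D' : FramedFODef R J M) : D.Iso D' := by
  obtain ⟨e, he⟩ := D.trivial_iso
  obtain ⟨e', he'⟩ := D'.trivial_iso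
  refine ⟨e.symm.trans e', fun x ↦ ?_, fun x ↦ ?_⟩ <;> obtain ⟨y, rfl⟩ := e.surjective x
  · rw [LinearEquiv.trans_apply, e.symm_apply_apply, (he y).1, (he' y).1]
  · rw [LinearEquiv.trans_apply, e.symm_apply_apply, (he y).2, (he' y).2]

end FramedFODef

/-- For a finitely generated projective module `M` over a commutative
`ℂ`-algebra `R` and an ideal `J ⊆ R`, the set of isomorphism classes of framed first-order
deformations of `M` (framed along `J` by `W₀ = M/JM`) is in bijection with
`Ext¹_R(M, JM)`. -/
theorem stmt6 (R : Type) [CommRing R] [Algebra ℂ R] (J : Ideal R)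
    (M : Type) [AddCommGroup M] [Module R M]
    [Module.Finite R M] [Module.Projective R M] :
    Nonempty ((Quot (FramedFODef.Iso (R := R) (J := J) (M := M))) ≃
      ((Ext R (ModuleCat.{0} R) 1).obj
        (Opposite.op (ModuleCat.of R M))).obj
        (ModuleCat.of R ↥(J • (⊤ : Submodule R M)))) := by
  have : Subsingleton (Quot (FramedFODef.Iso (R := R) (J := J) (M := M))) :=
    ⟨by rintro ⟨D⟩ ⟨D'⟩; exact Quot.sound (D.iso_of_projective D')⟩
  have hExt := isZero_Ext_succ_of_projective (R := R) (ModuleCat.of R M)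
    (ModuleCat.of R ↥(J • (⊤ : Submodule R M))) 0
  have := ModuleCat.subsingleton_of_isZero hExt
  exact ⟨{ toFun := fun _ ↦ 0
           invFun := fun _ ↦ Quot.mk _ (FramedFODef.trivial J M)
           left_inv := fun _ ↦ Subsingleton.elim _ _
           right_inv := fun _ ↦ Subsingleton.elim _ _ }⟩
end

section
/- Let n ≥ 1 and let H be a commutative ℚ-algebra with elements ω, η₁, …, ηₙ, p satisfying: ηᵢηⱼ = 0 for i ≠ j; ηᵢ³ = 0 for all i; ω²ηᵢ = p and ωηᵢ² = −p for all i; and ηᵢ² = −(ω² + ωη) for all i, where η := η₁ + ⋯ + ηₙ. Set f := ω² + ωη. Let a₁, …, aₙ ∈ {0, 1} and set σ := Σᵢ aᵢηᵢ and σ̄ := Σᵢ (1 − aᵢ)ηᵢ. Let r, k, m be integers and set c := k·f. For x ∈ H define Φ(x) := (r/24)·(4ω + 2η)·(m·f) + ((rω + rx)/12)·(16ω² + 4η² + 16ωη + m·f) + ((2ω + η)/2)·(r²ω² + r²x² + 2r²ωx − 2c − (r² − r)(ω² + x² + 2ωx)) + (r³/6)·(ω³ + 3ω²x + 3ωx²)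 − ((rω + rx)/2)·(c + ((r² − r)/2)(ω² + x² + 2ωx)) + ((r − 2)/6)·c·(ω + x) + ((r³ − 3r² + 2r)/36)·(ω³ + 3ω²x + 3ωx²). Then Φ(σ) = Φ(σ̄). -/
/-- For pairwise orthogonal `v i` with common square `-f`, the product of `Σ aᵢ vᵢ`
and `Σ bᵢ vᵢ` is `-(Σ aᵢ bᵢ) f`. -/
theorem sum_zsmul_mul_sum_of_orthogonal {H ι : Type*} [CommRing H] [Fintype ι]
    {v : ι → H} {f : H} (horth : ∀ i j, i ≠ j → v i * v j = 0)
    (hsq : ∀ i, v i ^ 2 = -f) (a b : ι → ℤ) :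
    (∑ i, a i • v i) * (∑ i, b i • v i) = -((∑ i, a i * b i : ℤ) : H) * f := by
  classical
  rw [Finset.sum_mul_sum, Int.cast_sum, ← Finset.sum_neg_distrib, Finset.sum_mul]
  refine Finset.sum_congr rfl fun i _ => ?_
  rw [Finset.sum_eq_single i]
  · simp only [zsmul_eq_mul, Int.cast_mul]
    linear_combination (a i : H) * b i * hsq i
  · intro j _ hj
    simp only [zsmul_eq_mul]
    linear_combination (a i : H) * b j * horth i j hj.symm
  · simp

/-- The Hirzebruch–Riemann–Roch expression
`Φ(x) = χ(End(V)(-S))` for `[S] = ω + x` in the rational cohomology ring of a twistor space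
over `#n (-ℂP²)` takes the same value at `σ = Σ aᵢ ηᵢ` and at `σ̄ = Σ (1 - aᵢ) ηᵢ`. -/
theorem stmt10 {H : Type*} [CommRing H] [Algebra ℚ H] (n : ℕ) (hn : 1 ≤ n)
    (ω p : H) (η' : Fin n → H)
    (horth : ∀ i j, i ≠ j → η' i * η' j = 0)
    (hcube : ∀ i, η' i ^ 3 = 0)
    (hω2η : ∀ i, ω ^ 2 * η' i = p)
    (hωη2 : ∀ i, ω * η' i ^ 2 = -p)
    (hη2 : ∀ i, η' i ^ 2 = -(ω ^ 2 + ω * ∑ j, η' j))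
    (a : Fin n → ℤ) (ha : ∀ i, a i = 0 ∨ a i = 1)
    (r k m : ℤ) :
    let η : H := ∑ j, η' j
    let f : H := ω ^ 2 + ω * η
    let σ : H := ∑ i, a i • η' i
    let σbar : H := ∑ i, (1 - a i) • η' i
    let c : H := k • f
    let Φ : H → H := fun x =>
      ((r : ℚ) / 24) • ((4 * ω + 2 * η) * (m • f)) +
      ((1 : ℚ) / 12) • (((r : ℚ) • ω + (r : ℚ) • x) *
        (16 * ω ^ 2 + 4 * η ^ 2 + 16 * ω * η + m • f)) +
      ((1 : ℚ) / 2) • ((2 * ω + η) *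
        (((r ^ 2 : ℤ) : ℚ) • ω ^ 2 + ((r ^ 2 : ℤ) : ℚ) • x ^ 2 +
          ((2 * r ^ 2 : ℤ) : ℚ) • (ω * x) - 2 * c -
          ((r ^ 2 - r : ℤ) : ℚ) • (ω ^ 2 + x ^ 2 + 2 * ω * x))) +
      (((r ^ 3 : ℤ) : ℚ) / 6) • (ω ^ 3 + 3 * ω ^ 2 * x + 3 * ω * x ^ 2) -
      ((1 : ℚ) / 2) • (((r : ℚ) • ω + (r : ℚ) • x) *
        (c + (((r ^ 2 - r : ℤ) : ℚ) / 2) • (ω ^ 2 + x ^ 2 + 2 * ω * x))) +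
      (((r - 2 : ℤ) : ℚ) / 6) • (c * (ω + x)) +
      (((r ^ 3 - 3 * r ^ 2 + 2 * r : ℤ) : ℚ) / 36) •
        (ω ^ 3 + 3 * ω ^ 2 * x + 3 * ω * x ^ 2)
    Φ σ = Φ σbar := by
  intro η f σ σbar c Φ
  have hsq : ∀ i, η' i ^ 2 = -f := hη2
  have hfη : ∀ i, f * η' i = 0 := fun i => by
    linear_combination η' i * hsq i - hcube i
  have hωf : ω * f = p := by
    linear_combination ω * hsq ⟨0, hn⟩ - hωη2 ⟨0, hn⟩
  have hηη : η = ∑ i, (1 : ℤ) • η' i := by simp [η]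
  have key : ∀ b : Fin n → ℤ, (∀ i, b i = 0 ∨ b i = 1) →
      Φ (∑ i, b i • η' i) = Φ 0 := by
    intro b hb
    obtain ⟨x, hx⟩ : ∃ x, x = ∑ i, b i • η' i := ⟨_, rfl⟩
    rw [← hx]
    have hbb : ∑ i, b i * b i = ∑ i, b i :=
      Finset.sum_congr rfl fun i _ => by rcases hb i with h | h <;> simp [h]
    have hfx : f * x = 0 := by
      rw [hx, Finset.mul_sum]
      exact Finset.sum_eq_zero fun i _ => by rw [mul_smul_comm, hfη, smul_zero]
    have hω2x : ω ^ 2 * x = ((∑ i, b i : ℤ) : H) * p := by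
      rw [hx, Finset.mul_sum, Int.cast_sum, Finset.sum_mul]
      exact Finset.sum_congr rfl fun i _ => by rw [mul_smul_comm, hω2η, zsmul_eq_mul]
    have hxx : x * x = -((∑ i, b i : ℤ) : H) * f := by
      rw [hx, sum_zsmul_mul_sum_of_orthogonal horth hsq, hbb]
    have hηx : η * x = -((∑ i, b i : ℤ) : H) * f := by
      rw [hx, hηη, sum_zsmul_mul_sum_of_orthogonal horth hsq]
      simp
    have hωx2 : ω ^ 2 * x + ω * x ^ 2 = 0 := by
      linear_combination hω2x + ω * hxx - ((∑ i, b i : ℤ) : H) * hωf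
    have hωηx : ω * η * x = -(ω ^ 2 * x) := by
      linear_combination hω2x + ω * hηx - ((∑ i, b i : ℤ) : H) * hωf
    have hx3 : x ^ 3 = 0 := by
      linear_combination x * hxx - ((∑ i, b i : ℤ) : H) * hfx
    have hηx2 : η * x ^ 2 = 0 := by
      linear_combination x * hηx - ((∑ i, b i : ℤ) : H) * hfx
    have hη2x : η ^ 2 * x = 0 := by
      linear_combination η * hηx - η * hxx + hηx2
    clear_value f η
    simp only [Φ, c, Algebra.smul_def, map_intCast]
    push_cast
    generalize algebraMap ℚ H (1 / 12) = A
    generalize algebraMap ℚ H (1 / 2) = B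
    generalize algebraMap ℚ H ((r : ℚ) ^ 3 / 6) = C
    generalize algebraMap ℚ H (((r : ℚ) ^ 2 - r) / 2) = D
    generalize algebraMap ℚ H (((r : ℚ) - 2) / 6) = E
    generalize algebraMap ℚ H (((r : ℚ) ^ 3 - 3 * r ^ 2 + 2 * r) / 36) = F
    linear_combination A * r * (16 * hωηx + 4 * hη2x + m * hfx)
      + B * r * (2 * hωx2 + hηx2 + 2 * hωηx) + 3 * C * hωx2
      - B * r * k * hfx - B * r * D * (3 * hωx2 + hx3) + E * k * hfx + 3 * F * hωx2
  rw [key a ha, key (fun i => 1 - a i) fun i => by rcases ha i with h | h <;> simp [h]]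
end

section
/- Let R be a commutative ℂ-algebra, J ⊆ R an ideal, M an R-module, and W₀ := M/JM. Let E be a module over R[ε] which is flat over the ring of dual numbers ℂ[ε], let ψ: E/εE ≅ M be an isomorphism of R-modules, and let α: E/JE ≅ W₀ ⊕ εW₀ be an isomorphism of R[ε]-modules (J acting through R ⊆ R[ε]) such that the isomorphism E/(JE + εE) ≅ W₀ induced by α coincides with the one induced by ψ followed by the canonical projection M → W₀. Let q: E → W₀ be the composition of the projection E → E/JE, the isomorphism α, and the projection W₀ ⊕ εW₀ → εW₀ ≅ W₀, and set F := ker(q). Let i: M → E be the composition of ψ⁻¹ with the isomorphism E/εE ≅ εE induced by multiplication by ε (which exists since E is flat over ℂ[ε]) and the inclusion εE ⊆ E. Then i⁻¹(F) = JM, and the sequence 0 → JM →(i) F → M → 0 is exact, where the map F → M is the restriction to F of the projection E → E/εE followed by ψ. -/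
open TrivSqZeroExt

/-- On a flat module over the dual numbers, the kernel of multiplication by `ε` is contained in
its image. -/
theorem exists_eps_smul_of_eps_smul_eq_zero {k E : Type*} [CommRing k] [AddCommGroup E]
    [Module (DualNumber k) E] [Module.Flat (DualNumber k) E] {x : E}
    (hx : (DualNumber.eps : DualNumber k) • x = 0) :
    ∃ y : E, x = (DualNumber.eps : DualNumber k) • y := by
  obtain ⟨_, a, y, hxy, ha⟩ := Module.Flat.isTrivialRelation_of_sum_smul_eq_zero
    (f := fun _ : Unit => (DualNumber.eps : DualNumber k)) (x := fun _ => x) (by simpa using hx)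
  have hfac : ∀ j, a () j = DualNumber.eps * inl (snd (a () j)) := by
    intro j
    have h : fst (a () j) = 0 := by
      simpa using congrArg snd (ha j)
    ext <;> simp [h]
  refine ⟨∑ j, (inl (snd (a () j)) : DualNumber k) • y j, ?_⟩
  refine (hxy ()).trans ?_
  rw [Finset.smul_sum]
  refine Finset.sum_congr rfl fun j _ => ?_
  rw [smul_smul, ← hfac]

/-- Let `E` be a framed first-order deformation of `M`: a module over
`R[ε]`, flat over `ℂ[ε]`, with `ψ : E/εE ≅ M` and a framing `α : E/JE ≅ W₀ ⊕ εW₀`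
compatible with `ψ`. Let `q : E → W₀` be the `εW₀`-component of the framing and
`F := ker q`, and let `i : M → E` be `ψ⁻¹` followed by the isomorphism `E/εE ≅ εE` given by
multiplication by `ε` and the inclusion `εE ⊆ E` (so `i` is characterized by
`i (ψ (mk x)) = ε • x`). Then `i⁻¹(F) = JM` and the sequence `0 → JM →(i) F → M → 0` is
exact, the map `F → M` being the restriction of `E → E/εE ≅ M`. -/
theorem stmt11 {R M E : Type} [CommRing R] [Algebra ℂ R] (J : Ideal R)
    [AddCommGroup M] [Module R M]
    [AddCommGroup E] [Module (DualNumber R) E]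
    [Module R E] [IsScalarTower R (DualNumber R) E]
    [Module (DualNumber ℂ) E]
    -- the `ℂ[ε]`-module structure is the restriction of the `R[ε]`-module structure
    (hcompat : ∀ (d : DualNumber ℂ) (x : E),
      d • x = (inl (algebraMap ℂ R (fst d)) + inr (algebraMap ℂ R (snd d)) : DualNumber R) • x)
    -- `E` is flat over the dual numbers `ℂ[ε]`
    [Module.Flat (DualNumber ℂ) E]
    -- multiplication by `ε` on `E`, as an `R`-linear map; `εE = range ℓ`
    (ℓ : E →ₗ[R] E)
    (hℓ : ℓ = (LinearMap.lsmul (DualNumber R) E (DualNumber.eps)).restrictScalars R)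
    -- `ψ : E/εE ≅ M`
    (ψ : (E ⧸ LinearMap.range ℓ) ≃ₗ[R] M)
    -- the framing `α : E/JE ≅ W₀ ⊕ εW₀`, where `W₀ = M/JM`
    (α : (E ⧸ (J • (⊤ : Submodule R E))) ≃ₗ[R]
      ((M ⧸ (J • (⊤ : Submodule R M))) × (M ⧸ (J • (⊤ : Submodule R M)))))
    -- `α` is `R[ε]`-linear: `ε` sends `w₁ + εw₂` to `εw₁`
    (hαε : ∀ x : E,
      α (Submodule.Quotient.mk ((DualNumber.eps : DualNumber R) • x))
        = (0, (α (Submodule.Quotient.mk x)).1))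
    -- compatibility of `α` and `ψ`: both induce the same isomorphism `E/(JE + εE) ≅ W₀`
    (hαψ : ∀ x : E,
      Submodule.Quotient.mk (p := J • (⊤ : Submodule R M)) (ψ (Submodule.Quotient.mk x))
        = (α (Submodule.Quotient.mk x)).1) :
    -- `q : E → W₀` and `F := ker q`
    let q : E →ₗ[R] (M ⧸ (J • (⊤ : Submodule R M))) :=
      LinearMap.snd R _ _ ∘ₗ α.toLinearMap ∘ₗ (J • (⊤ : Submodule R E)).mkQ
    let F : Submodule R E := LinearMap.ker q
    -- `π : E → M` is the projection `E → E/εE` followed by `ψ`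
    let π : E →ₗ[R] M := ψ.toLinearMap ∘ₗ (LinearMap.range ℓ).mkQ
    -- `i : M → E` is characterized by `i (ψ (mk x)) = ℓ x = ε • x`
    ∀ i : M →ₗ[R] E, (∀ x : E, i (ψ (Submodule.Quotient.mk x)) = ℓ x) →
      -- `i⁻¹(F) = JM`
      Submodule.comap i F = J • (⊤ : Submodule R M) ∧
      -- exactness of `0 → JM →(i) F → M → 0`
      Set.InjOn i ↑(J • (⊤ : Submodule R M)) ∧
      Submodule.map i (J • (⊤ : Submodule R M)) = F ⊓ LinearMap.ker π ∧
      Submodule.map π F = ⊤ := by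
  intro q F π i hi
  have hqi : q ∘ₗ i = (J • (⊤ : Submodule R M)).mkQ := by
    ext m
    obtain ⟨y, rfl⟩ := ψ.surjective m
    obtain ⟨x, rfl⟩ := Submodule.Quotient.mk_surjective _ y
    have h := congrArg Prod.snd (hαε x)
    simp only [LinearMap.comp_apply, hi, Submodule.mkQ_apply, hαψ]
    subst hℓ
    exact h
  have hcomap : Submodule.comap i F = J • (⊤ : Submodule R M) := by
    rw [← LinearMap.ker_comp, hqi, Submodule.ker_mkQ]
  have hπ : LinearMap.ker π = LinearMap.range i := by
    have hiℓ : i ∘ₗ π = ℓ := LinearMap.ext hi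
    have hsurj : LinearMap.range π = ⊤ := by
      simp [π, LinearMap.range_comp]
    calc LinearMap.ker π = LinearMap.range ℓ := by simp [π]
      _ = LinearMap.range i := by
        rw [← hiℓ, LinearMap.range_comp, hsurj, LinearMap.range_eq_map]
  have heps : ∀ x : E, (DualNumber.eps : DualNumber ℂ) • x = ℓ x := by
    intro x
    rw [hcompat, hℓ]
    change _ = (DualNumber.eps : DualNumber R) • x
    congr 1
    ext <;> simp
  have hinj : Function.Injective i := by
    rw [injective_iff_map_eq_zero]
    intro m hm
    obtain ⟨y, rfl⟩ := ψ.surjective m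
    obtain ⟨x, rfl⟩ := Submodule.Quotient.mk_surjective _ y
    rw [hi, ← heps] at hm
    obtain ⟨y, rfl⟩ := exists_eps_smul_of_eps_smul_eq_zero hm
    rw [heps, (Submodule.Quotient.mk_eq_zero _).2 (LinearMap.mem_range_self ℓ y), map_zero]
  refine ⟨hcomap, hinj.injOn, ?_, ?_⟩
  · rw [← hcomap, Submodule.map_comap_eq, hπ, inf_comm]
  · rw [eq_top_iff]
    rintro m -
    obtain ⟨y, rfl⟩ := ψ.surjective m
    obtain ⟨x, rfl⟩ := Submodule.Quotient.mk_surjective _ y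
    obtain ⟨m', hm'⟩ := Submodule.Quotient.mk_surjective _ (q x)
    refine ⟨x - i m', ?_, ?_⟩
    · have h : q (i m') = q x := (LinearMap.congr_fun hqi m').trans hm'
      change q (x - i m') = 0
      rw [map_sub, h, sub_self]
    · have h : π (i m') = 0 := by
        rw [← LinearMap.mem_ker, hπ]
        exact LinearMap.mem_range_self i m'
      rw [map_sub, h, sub_zero]
      rfl
end
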